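/- Let n and m be positive integers, s, t > 0, and let X and Y be independent real random variables with the inverse-gamma distributions iG(n, s) and iG(m, t), respectively, and set p = s/(s+t). Then for every natural number k with k < n: E[X^k · 1_{X ≥ Y}] = (Γ(n−k) s^k / Γ(n)) · I_p(n−k, m); and for every natural number k with k < m: E[Y^k · 1_{X ≥ Y}] = (Γ(m−k) t^k / Γ(m)) · I_p(n, m−k). -/

import Mathlib

open MeasureTheory ProbabilityTheory

/-- The regularized incomplete beta function `I_p(n, m)` for positive integer
parameters `n, m`. -/
noncomputable def regIncBeta (n m : ℕ) (p : ℝ) : ℝ :=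
  (Real.Gamma (n + m) / (Real.Gamma n * Real.Gamma m)) *
    ∫ u in (0:ℝ)..p, u ^ (n - 1) * (1 - u) ^ (m - 1)

/-- The density of the inverse-gamma distribution `iG(n, s)` with shape `n` and
scale `s`: `s^n/Γ(n) ⬝ x^{-n-1} e^{-s/x}` on `(0, ∞)`. -/
noncomputable def invGammaPDFReal (n : ℕ) (s x : ℝ) : ℝ :=
  if 0 < x then s ^ n / Real.Gamma n * x ^ (-(n : ℤ) - 1) * Real.exp (-(s / x)) else 0

/-- The inverse-gamma measure `iG(n, s)` on `ℝ`. -/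
noncomputable def invGammaMeasure (n : ℕ) (s : ℝ) : Measure ℝ :=
  volume.withDensity fun x => ENNReal.ofReal (invGammaPDFReal n s x)

lemma aux_gamma (N : ℕ) (hN : 0 < N) (c : ℝ) (hc : 0 < c) :
    ∫⁻ x in Set.Ioi (0:ℝ), ENNReal.ofReal (x ^ (-(N:ℤ) - 1) * Real.exp (-(c / x)))
      = ENNReal.ofReal (Real.Gamma N / c ^ N) := by
  have hN' : (0:ℝ) < N := by exact_mod_cast hN
  have key : ∀ x ∈ Set.Ioi (0:ℝ), x ^ (-(N:ℤ) - 1) * Real.exp (-(c / x)) =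
      (|(-1:ℝ)| * x ^ ((-1:ℝ) - 1)) • (fun y : ℝ => y ^ ((N:ℝ) - 1) * Real.exp (-(c * y))) (x ^ (-1:ℝ)) := by
    intro x hx
    have hx : 0 < x := hx
    simp only [abs_neg, abs_one, one_mul, smul_eq_mul]
    rw [← Real.rpow_mul hx.le, ← mul_assoc, ← Real.rpow_add hx, Real.rpow_neg_one,
      ← Real.rpow_intCast]
    congr 2
    push_cast
    ring
  have hI : IntegrableOn (fun y : ℝ => y ^ ((N:ℝ) - 1) * Real.exp (-(c * y))) (Set.Ioi 0) := by
    by_contra h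
    have h1 := Real.integral_rpow_mul_exp_neg_mul_Ioi hN' hc
    rw [integral_undef h] at h1
    have : 0 < (1 / c) ^ (N:ℝ) * Real.Gamma N :=
      mul_pos (Real.rpow_pos_of_pos (by positivity) _) (Real.Gamma_pos_of_pos hN')
    linarith
  rw [← ofReal_integral_eq_lintegral_ofReal]
  · congr 1
    rw [setIntegral_congr_fun measurableSet_Ioi key,
      integral_comp_rpow_Ioi (fun y : ℝ => y ^ ((N:ℝ) - 1) * Real.exp (-(c * y))) (by norm_num),
      Real.integral_rpow_mul_exp_neg_mul_Ioi hN' hc, Real.rpow_natCast, div_pow, one_pow]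
    field_simp
  · have := (integrableOn_Ioi_comp_rpow_iff (fun y : ℝ => y ^ ((N:ℝ) - 1) * Real.exp (-(c * y)))
      (p := -1) (by norm_num)).2 hI
    exact this.congr_fun (fun x hx => (key x hx).symm) measurableSet_Ioi
  · filter_upwards [ae_restrict_mem measurableSet_Ioi] with x hx
    have hx : 0 < x := hx
    positivity

lemma aux_scale (x : ℝ) (hx : 0 < x) (f : ℝ → ENNReal) :
    ∫⁻ y in Set.Ioc 0 x, f y = ∫⁻ z in Set.Ioc 0 1, ENNReal.ofReal x * f (x * z) := by
  have himg : (fun z => x * z) '' Set.Ioc (0:ℝ) 1 = Set.Ioc 0 x := by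
    rw [Set.image_mul_left_Ioc hx]; simp
  rw [← himg, lintegral_image_eq_lintegral_abs_deriv_mul (f' := fun _ => x) measurableSet_Ioc]
  · rw [abs_of_pos hx]
  · intro z _
    simpa using ((hasDerivAt_id z).const_mul x).hasDerivWithinAt
  · exact (mul_right_injective₀ hx.ne').injOn

lemma aux_beta (a b : ℕ) (ha : 0 < a) (hb : 0 < b) (s t : ℝ) (hs : 0 < s) (ht : 0 < t) :
    ∫⁻ z in Set.Ioc (0:ℝ) 1, ENNReal.ofReal (z ^ (a - 1) / (s * z + t) ^ (a + b))
      = ENNReal.ofReal ((∫ u in (0:ℝ)..(s / (s + t)), u ^ (a - 1) * (1 - u) ^ (b - 1))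
          / (s ^ a * t ^ b)) := by
  have hpos : ∀ z ∈ Set.Icc (0:ℝ) 1, 0 < s * z + t := fun z hz => by
    have := mul_nonneg hs.le hz.1
    linarith
  have hcont : ContinuousOn (fun z : ℝ => z ^ (a - 1) / (s * z + t) ^ (a + b)) (Set.Icc 0 1) :=
    ContinuousOn.div (by fun_prop) (by fun_prop) (fun z hz => (pow_pos (hpos z hz) _).ne')
  rw [← ofReal_integral_eq_lintegral_ofReal]
  · congr 1
    rw [← intervalIntegral.integral_of_le zero_le_one, eq_div_iff (by positivity)]
    have h := intervalIntegral.integral_comp_mul_deriv (a := 0) (b := 1)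
      (f := fun z => s * z / (s * z + t)) (f' := fun z => s * t / (s * z + t) ^ 2)
      (g := fun u => u ^ (a - 1) * (1 - u) ^ (b - 1)) ?_ ?_ (by fun_prop)
    · simp only [mul_zero, zero_div, mul_one] at h
      rw [← h, ← intervalIntegral.integral_mul_const]
      apply intervalIntegral.integral_congr
      intro z hz
      rw [Set.uIcc_of_le zero_le_one] at hz
      have hp := hpos z hz
      obtain ⟨a, rfl⟩ : ∃ k, a = k + 1 := ⟨a - 1, by omega⟩
      obtain ⟨b, rfl⟩ : ∃ k, b = k + 1 := ⟨b - 1, by omega⟩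
      have h1 : 1 - s * z / (s * z + t) = t / (s * z + t) := by field_simp; ring
      simp only [Function.comp, h1, Nat.add_sub_cancel, div_pow, mul_pow]
      field_simp
      ring
    · intro z hz
      rw [Set.uIcc_of_le zero_le_one] at hz
      have hp := hpos z hz
      have h1 : HasDerivAt (fun z => s * z) s z := by
        simpa using (hasDerivAt_id z).const_mul s
      have h2 := h1.div (h1.add_const t) hp.ne'
      have h3 : s * t / (s * z + t) ^ 2 = (s * (s * z + t) - s * z * s) / (s * z + t) ^ 2 := by
        congr 1
        ring
      beta_reduce
      rw [h3]
      exact h2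
    · rw [Set.uIcc_of_le zero_le_one]
      exact ContinuousOn.div (by fun_prop) (by fun_prop) (fun z hz => (pow_pos (hpos z hz) _).ne')
  · exact (hcont.integrableOn_Icc).mono_set Set.Ioc_subset_Icc_self
  · filter_upwards [ae_restrict_mem measurableSet_Ioc] with z hz
    have := hpos z ⟨hz.1.le, hz.2⟩
    have := hz.1
    positivity

lemma aux_meas (n : ℕ) (s : ℝ) : Measurable (invGammaPDFReal n s) := by
  unfold invGammaPDFReal
  refine Measurable.ite measurableSet_Ioi ?_ measurable_const
  fun_prop

lemma aux_ne_zero (n : ℕ) (hn : 0 < n) (s : ℝ) (hs : 0 < s) : invGammaMeasure n s ≠ 0 := by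
  intro h
  have hn' : (0:ℝ) < n := by exact_mod_cast hn
  have hG := Real.Gamma_pos_of_pos hn'
  unfold invGammaMeasure at h
  rw [withDensity_eq_zero_iff (aux_meas n s).ennreal_ofReal.aemeasurable] at h
  have h2 : ∀ᵐ x : ℝ, x ∉ Set.Ioi (0:ℝ) := by
    filter_upwards [h] with x hx hx0
    have hx0 : 0 < x := hx0
    simp only [Pi.zero_apply, ENNReal.ofReal_eq_zero, invGammaPDFReal, if_pos hx0] at hx
    have : 0 < s ^ n / Real.Gamma n * x ^ (-(n : ℤ) - 1) * Real.exp (-(s / x)) := by positivity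
    linarith
  have := measure_eq_zero_iff_ae_notMem.2 h2
  simp at this

lemma aux_ae_pos (n : ℕ) (s : ℝ) : ∀ᵐ x ∂(invGammaMeasure n s), 0 < x := by
  unfold invGammaMeasure
  rw [ae_withDensity_iff (aux_meas n s).ennreal_ofReal]
  refine Filter.Eventually.of_forall fun x hx => ?_
  by_contra h
  simp [invGammaPDFReal, h] at hx

lemma aux_double (n m i j : ℕ) (hi : i < n) (hj : j < m) (s t : ℝ) (hs : 0 < s) (ht : 0 < t) :
    ∫⁻ x, ENNReal.ofReal (invGammaPDFReal n s x) * ∫⁻ y, ENNReal.ofReal (invGammaPDFReal m t y) *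
        ({q : ℝ × ℝ | q.2 ≤ q.1}.indicator (fun q => ENNReal.ofReal (q.1 ^ i * q.2 ^ j)) (x, y))
      = ENNReal.ofReal (s ^ n / Real.Gamma n * (t ^ m / Real.Gamma m) *
          Real.Gamma ((n - i + (m - j) : ℕ) : ℝ) *
          ((∫ u in (0:ℝ)..(s / (s + t)), u ^ (n - i - 1) * (1 - u) ^ (m - j - 1))
          / (s ^ (n - i) * t ^ (m - j)))) := by
  have hn' : (0:ℝ) < n := by exact_mod_cast (by omega : 0 < n)
  have hm' : (0:ℝ) < m := by exact_mod_cast (by omega : 0 < m)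
  have hGn := Real.Gamma_pos_of_pos hn'
  have hGm := Real.Gamma_pos_of_pos hm'
  obtain ⟨a, rfl⟩ : ∃ a, n = a + 1 + i := ⟨n - i - 1, by omega⟩
  obtain ⟨b, rfl⟩ : ∃ b, m = b + 1 + j := ⟨m - j - 1, by omega⟩
  rw [Nat.add_sub_cancel, Nat.add_sub_cancel]
  set C := s ^ (a + 1 + i) / Real.Gamma ((a + 1 + i : ℕ) : ℝ) with hC
  set D := t ^ (b + 1 + j) / Real.Gamma ((b + 1 + j : ℕ) : ℝ) with hD
  have hCp : 0 < C := by positivity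
  have hDp : 0 < D := by positivity
  set N := a + 1 + (b + 1) with hN
  have hGN : 0 < Real.Gamma (N : ℝ) := Real.Gamma_pos_of_pos (by positivity)
  -- the integrand after scaling
  set H : ℝ → ℝ → ENNReal := fun x z => ENNReal.ofReal (C * D * z ^ (-((b + 1 : ℕ) : ℤ) - 1)) *
    ENNReal.ofReal (x ^ (-(N : ℤ) - 1) * Real.exp (-((s + t / z) / x))) with hH
  have hHm : Measurable (Function.uncurry H) := by
    simp only [hH, Function.uncurry_def]
    fun_prop
  have step1 : ∀ x : ℝ, ENNReal.ofReal (invGammaPDFReal (a + 1 + i) s x) *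
      ∫⁻ y, ENNReal.ofReal (invGammaPDFReal (b + 1 + j) t y) *
        ({q : ℝ × ℝ | q.2 ≤ q.1}.indicator (fun q => ENNReal.ofReal (q.1 ^ i * q.2 ^ j)) (x, y))
      = (Set.Ioi (0:ℝ)).indicator (fun x => ∫⁻ z in Set.Ioc (0:ℝ) 1, H x z) x := by
    intro x
    by_cases hx : 0 < x
    swap
    · simp [invGammaPDFReal, hx]
    rw [Set.indicator_of_mem (show x ∈ Set.Ioi (0:ℝ) from hx)]
    have e1 : ∀ y : ℝ, ENNReal.ofReal (invGammaPDFReal (b + 1 + j) t y) *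
        ({q : ℝ × ℝ | q.2 ≤ q.1}.indicator (fun q => ENNReal.ofReal (q.1 ^ i * q.2 ^ j)) (x, y))
        = (Set.Ioc 0 x).indicator (fun y => ENNReal.ofReal
          (D * y ^ (-((b + 1 + j : ℕ) : ℤ) - 1) * Real.exp (-(t / y)) * (x ^ i * y ^ j))) y := by
      intro y
      by_cases hy : 0 < y
      · by_cases hxy : y ≤ x
        · rw [Set.indicator_of_mem (show (x, y) ∈ {q : ℝ × ℝ | q.2 ≤ q.1} from hxy),
            Set.indicator_of_mem (show y ∈ Set.Ioc 0 x from ⟨hy, hxy⟩), ← ENNReal.ofReal_mul]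
          · simp only [invGammaPDFReal, if_pos hy, hD]
          · simp only [invGammaPDFReal, if_pos hy]
            positivity
        · simp [hxy]
      · simp [invGammaPDFReal, hy]
    simp_rw [e1]
    rw [lintegral_indicator measurableSet_Ioc, aux_scale x hx,
      ← lintegral_const_mul _ (by fun_prop)]
    refine setLIntegral_congr_fun measurableSet_Ioc fun z hz => ?_
    have hz0 : 0 < z := hz.1
    simp only [hH, invGammaPDFReal, if_pos hx]
    rw [← hC, ← ENNReal.ofReal_mul (by positivity), ← ENNReal.ofReal_mul (by positivity),
      ← ENNReal.ofReal_mul (by positivity)]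
    congr 1
    have hexp : Real.exp (-((s + t / z) / x)) = Real.exp (-(s / x)) * Real.exp (-(t / (x * z))) := by
      rw [← Real.exp_add]
      congr 1
      field_simp
      ring
    rw [hexp]
    have zp : ∀ (k : ℕ) (w : ℝ), 0 < w → w ^ (-(k : ℤ) - 1) = 1 / w ^ (k + 1) := by
      intro k w hw
      rw [show (-(k:ℤ) - 1) = -((k + 1 : ℕ) : ℤ) by push_cast; ring, zpow_neg, zpow_natCast, one_div]
    rw [zp _ _ hx, zp _ _ hx, zp _ _ hz0, zp _ _ (mul_pos hx hz0), hN]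
    simp only [mul_pow]
    field_simp
    ring
  simp_rw [step1]
  rw [lintegral_indicator measurableSet_Ioi, lintegral_lintegral_swap hHm.aemeasurable]
  have step2 : ∀ z ∈ Set.Ioc (0:ℝ) 1, ∫⁻ x in Set.Ioi (0:ℝ), H x z =
      ENNReal.ofReal (C * D * Real.Gamma N) *
        ENNReal.ofReal (z ^ (a + 1 - 1) / (s * z + t) ^ (a + 1 + (b + 1))) := by
    intro z hz
    have hz0 : 0 < z := hz.1
    simp only [hH]
    rw [lintegral_const_mul _ (by fun_prop), aux_gamma N (by omega) _ (by positivity),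
      ← ENNReal.ofReal_mul (by positivity), ← ENNReal.ofReal_mul (by positivity)]
    congr 1
    rw [show (-((b + 1 : ℕ):ℤ) - 1) = -((b + 2 : ℕ) : ℤ) by push_cast; ring, zpow_neg, zpow_natCast,
      show s + t / z = (s * z + t) / z by field_simp, div_pow, ← hN,
      show z ^ N = z ^ (b + 2) * z ^ (a + 1 - 1) by rw [← pow_add]; congr 1; omega]
    field_simp
  rw [setLIntegral_congr_fun measurableSet_Ioc step2, lintegral_const_mul _ (by fun_prop),
    aux_beta (a + 1) (b + 1) (by omega) (by omega) s t hs ht, ← ENNReal.ofReal_mul (by positivity)]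

lemma aux_main
    {Ω : Type*} {mΩ : MeasurableSpace Ω} (P : Measure Ω) [IsProbabilityMeasure P]
    (n m i j : ℕ) (hi : i < n) (hj : j < m) (s t : ℝ) (hs : 0 < s) (ht : 0 < t)
    (X Y : Ω → ℝ)
    (hX : Measure.map X P = invGammaMeasure n s)
    (hY : Measure.map Y P = invGammaMeasure m t)
    (hXY : IndepFun X Y P) :
    ∫ ω in {ω | X ω ≥ Y ω}, X ω ^ i * Y ω ^ j ∂P =
      s ^ n / Real.Gamma n * (t ^ m / Real.Gamma m) *
          Real.Gamma ((n - i + (m - j) : ℕ) : ℝ) *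
          ((∫ u in (0:ℝ)..(s / (s + t)), u ^ (n - i - 1) * (1 - u) ^ (m - j - 1))
          / (s ^ (n - i) * t ^ (m - j))) := by
  have hXm : AEMeasurable X P := by
    by_contra h
    exact aux_ne_zero n (by omega) s hs (by rw [← hX, Measure.map_of_not_aemeasurable h])
  have hYm : AEMeasurable Y P := by
    by_contra h
    exact aux_ne_zero m (by omega) t ht (by rw [← hY, Measure.map_of_not_aemeasurable h])
  have hXp : ∀ᵐ ω ∂P, 0 < X ω := ae_of_ae_map hXm (by rw [hX]; exact aux_ae_pos n s)
  have hYp : ∀ᵐ ω ∂P, 0 < Y ω := ae_of_ae_map hYm (by rw [hY]; exact aux_ae_pos m t)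
  have hprod := (indepFun_iff_map_prod_eq_prod_map_map hXm hYm).1 hXY
  have hS : NullMeasurableSet {ω | X ω ≥ Y ω} P := nullMeasurableSet_le hYm hXm
  have hFm : Measurable ({q : ℝ × ℝ | q.2 ≤ q.1}.indicator
      (fun q => ENNReal.ofReal (q.1 ^ i * q.2 ^ j))) :=
    Measurable.indicator (by fun_prop) (measurableSet_le measurable_snd measurable_fst)
  have hn' : (0:ℝ) < n := by exact_mod_cast (by omega : 0 < n)
  have hm' : (0:ℝ) < m := by exact_mod_cast (by omega : 0 < m)
  have hGn := Real.Gamma_pos_of_pos hn'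
  have hGm := Real.Gamma_pos_of_pos hm'
  have hGN : 0 < Real.Gamma ((n - i + (m - j) : ℕ) : ℝ) := Real.Gamma_pos_of_pos
    (by exact_mod_cast (by omega : 0 < n - i + (m - j)))
  rw [integral_eq_lintegral_of_nonneg_ae]
  · rw [← lintegral_indicator₀ hS]
    have e : ∀ ω, ({ω | X ω ≥ Y ω}.indicator (fun ω => ENNReal.ofReal (X ω ^ i * Y ω ^ j))) ω =
        ({q : ℝ × ℝ | q.2 ≤ q.1}.indicator (fun q => ENNReal.ofReal (q.1 ^ i * q.2 ^ j)))
          (X ω, Y ω) := fun ω => by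
      simp only [Set.indicator, Set.mem_ofPred_eq, ge_iff_le]
    simp_rw [e]
    rw [← lintegral_map' (f := {q : ℝ × ℝ | q.2 ≤ q.1}.indicator
      (fun q => ENNReal.ofReal (q.1 ^ i * q.2 ^ j))) (g := fun ω => (X ω, Y ω))
      hFm.aemeasurable (hXm.prodMk hYm), hprod, hX, hY]
    unfold invGammaMeasure
    rw [lintegral_prod _ hFm.aemeasurable,
      lintegral_withDensity_eq_lintegral_mul _ (aux_meas n s).ennreal_ofReal
        hFm.lintegral_prod_right']
    have e2 : ∀ x, ∫⁻ y, ({q : ℝ × ℝ | q.2 ≤ q.1}.indicator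
        (fun q => ENNReal.ofReal (q.1 ^ i * q.2 ^ j))) (x, y)
          ∂(volume.withDensity fun x => ENNReal.ofReal (invGammaPDFReal m t x)) =
        ∫⁻ y, ENNReal.ofReal (invGammaPDFReal m t y) *
        ({q : ℝ × ℝ | q.2 ≤ q.1}.indicator (fun q => ENNReal.ofReal (q.1 ^ i * q.2 ^ j)) (x, y)) := by
      intro x
      exact lintegral_withDensity_eq_lintegral_mul _ (aux_meas m t).ennreal_ofReal
        (hFm.comp measurable_prodMk_left)
    simp only [Pi.mul_apply, e2]
    rw [aux_double n m i j hi hj s t hs ht, ENNReal.toReal_ofReal]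
    have : 0 ≤ ∫ u in (0:ℝ)..(s / (s + t)), u ^ (n - i - 1) * (1 - u) ^ (m - j - 1) := by
      apply intervalIntegral.integral_nonneg (by positivity)
      intro u hu
      have h1 : s / (s + t) ≤ 1 := by rw [div_le_one (by positivity)]; linarith
      have h2 : 0 ≤ 1 - u := by linarith [hu.2]
      have h3 := hu.1
      positivity
    positivity
  · filter_upwards [ae_restrict_of_ae hXp, ae_restrict_of_ae hYp] with ω h1 h2
    simp only [Pi.zero_apply]
    positivity
  · exact (((hXm.pow_const i).mul (hYm.pow_const j)).aestronglyMeasurable).restrict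

/-- Moments of independent inverse-gamma random variables `X ~ iG(n, s)` and
`Y ~ iG(m, t)` on the event `{X ≥ Y}`, with `p = s/(s+t)`:
for `k < n`, `E[X^k ⬝ 1_{X ≥ Y}] = (Γ(n-k) s^k / Γ(n)) ⬝ I_p(n-k, m)`, and
for `k < m`, `E[Y^k ⬝ 1_{X ≥ Y}] = (Γ(m-k) t^k / Γ(m)) ⬝ I_p(n, m-k)`. -/
theorem moments_on_ge_event_invGamma
    {Ω : Type*} {mΩ : MeasurableSpace Ω} (P : Measure Ω) [IsProbabilityMeasure P]
    (n m : ℕ) (hn : 0 < n) (hm : 0 < m) (s t : ℝ) (hs : 0 < s) (ht : 0 < t)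
    (X Y : Ω → ℝ)
    (hX : Measure.map X P = invGammaMeasure n s)
    (hY : Measure.map Y P = invGammaMeasure m t)
    (hXY : IndepFun X Y P) :
    (∀ k : ℕ, k < n →
        ∫ ω in {ω | X ω ≥ Y ω}, X ω ^ k ∂P =
          Real.Gamma (n - k) * s ^ k / Real.Gamma n *
            regIncBeta (n - k) m (s / (s + t))) ∧
      (∀ k : ℕ, k < m →
        ∫ ω in {ω | X ω ≥ Y ω}, Y ω ^ k ∂P =
          Real.Gamma (m - k) * t ^ k / Real.Gamma m *
            regIncBeta n (m - k) (s / (s + t))) := by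
  constructor
  · intro k hk
    have h := aux_main P n m k 0 hk hm s t hs ht X Y hX hY hXY
    simp only [pow_zero, mul_one, Nat.sub_zero] at h
    rw [h]
    have hGn := Real.Gamma_pos_of_pos (show (0:ℝ) < n by exact_mod_cast hn)
    have hGm := Real.Gamma_pos_of_pos (show (0:ℝ) < m by exact_mod_cast hm)
    have hc : ((n - k : ℕ) : ℝ) = (n : ℝ) - k := Nat.cast_sub hk.le
    have hG := Real.Gamma_pos_of_pos (show (0:ℝ) < (n : ℝ) - k by
      rw [sub_pos]; exact_mod_cast hk)
    have hpw : s ^ n = s ^ (n - k) * s ^ k := by rw [← pow_add]; congr 1; omega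
    unfold regIncBeta
    rw [Nat.cast_add, hc, hpw]
    field_simp
  · intro k hk
    have h := aux_main P n m 0 k hn hk s t hs ht X Y hX hY hXY
    simp only [pow_zero, one_mul, Nat.sub_zero] at h
    rw [h]
    have hGn := Real.Gamma_pos_of_pos (show (0:ℝ) < n by exact_mod_cast hn)
    have hGm := Real.Gamma_pos_of_pos (show (0:ℝ) < m by exact_mod_cast hm)
    have hc : ((m - k : ℕ) : ℝ) = (m : ℝ) - k := Nat.cast_sub hk.le
    have hG := Real.Gamma_pos_of_pos (show (0:ℝ) < (m : ℝ) - k by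
      rw [sub_pos]; exact_mod_cast hk)
    have hpw : t ^ m = t ^ (m - k) * t ^ k := by rw [← pow_add]; congr 1; omega
    unfold regIncBeta
    rw [Nat.cast_add, hc, hpw]
    field_simp
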